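/- (Classification of osp(1|2) ⊕ u(1) Lie super-bialgebras.) Let δ : G → G⊗G be a co-Lie structure on the Lie superalgebra G = osp(1|2) ⊕ u(1) (i.e. δ satisfies the parity condition, graded antisymmetry, the graded co-Jacobi identity, and the 1-cocycle condition). Then there exist an even automorphism A of G, a complex number x, and an r-matrix r from the following list, such that δ(A v) = (A⊗A)(v·r) for all v ∈ G: r₁ = H∧X₊; r₂ = Z∧X₊; r₃ = H∧X₊ + Z∧X₊; r₄ = H∧X₊ − Q₊∧Q₊; r₅ = H∧X₊ − Q₊∧Q₊ + Z∧X₊; r₆ = x(X₊∧X₋ + 2Q₊∧Q₋); r₇ = x(X₊∧X₋ + 2Q₊∧Q₋) + H∧Z. -/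

import Mathlib

noncomputable section

open scoped BigOperators

/-- The underlying vector space of `osp(1|2) ⊕ u(1)`, with coordinates in the basis
`(g₀,…,g₅) = (H, X₊, X₋, Z, Q₊, Q₋)`. -/
abbrev G := Fin 6 → ℂ

/-- `G ⊗ G`, represented by coefficient matrices in the basis `gᵢ ⊗ gⱼ`. -/
abbrev TT := Fin 6 → Fin 6 → ℂ

/-- The grade: `H, X₊, X₋, Z` are even (0); `Q₊, Q₋` are odd (1). -/
def gr (i : Fin 6) : ℕ := if i.val < 4 then 0 else 1

/-- The sign `z(i,j) = (−1)^{|i||j|}`. -/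
def zz (i j : Fin 6) : ℂ := (-1 : ℂ) ^ (gr i * gr j)

/-- Structure constants of `osp(1|2) ⊕ u(1)` (on `ℕ` indices, 0 outside the table). -/
def cNat : ℕ → ℕ → ℕ → ℂ
  | 0,1,1 => 1 | 1,0,1 => -1
  | 0,2,2 => -1 | 2,0,2 => 1
  | 1,2,0 => -2 | 2,1,0 => 2
  | 0,4,4 => 1/2 | 4,0,4 => -1/2
  | 0,5,5 => -1/2 | 5,0,5 => 1/2
  | 1,5,4 => -1 | 5,1,4 => 1
  | 2,4,5 => 1 | 4,2,5 => -1
  | 4,5,0 => 1/2 | 5,4,0 => 1/2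
  | 4,4,1 => 1/2
  | 5,5,2 => 1/2
  | _,_,_ => 0

/-- Structure constants `c i j k`, so that `μ(gᵢ,gⱼ) = Σ_k c i j k • g_k`. -/
def c (i j k : Fin 6) : ℂ := cNat i.val j.val k.val

/-- The bracket `μ` of `osp(1|2) ⊕ u(1)`, extended bilinearly from the basis. -/
def mu (u v : G) : G := fun k => ∑ i, ∑ j, u i * v j * c i j k

/-- The basis vectors `g₀,…,g₅`. -/
def e (i : Fin 6) : G := Pi.single i 1

/-- Membership in the even part `G₀ = span{H, X₊, X₋, Z}`. -/
def isEven (v : G) : Prop := ∀ i : Fin 6, 4 ≤ i.val → v i = 0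

/-- Membership in the odd part `G₁ = span{Q₊, Q₋}`. -/
def isOdd (v : G) : Prop := ∀ i : Fin 6, i.val < 4 → v i = 0

/-- The action of the basis vector `gᵢ` on `G ⊗ G`:
`gᵢ·(u⊗v) = μ(gᵢ,u)⊗v + (−1)^{|i||u|} u⊗μ(gᵢ,v)`. -/
def actB (i : Fin 6) (r : TT) : TT :=
  fun p q => (∑ j, c i j p * r j q) + zz i p * ∑ j, c i j q * r p j

/-- The (bilinearly extended) action `x ↦ x·r` of `G` on `G ⊗ G`, as a linear map in `x`. -/
def actL (r : TT) : G →ₗ[ℂ] TT :=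
  ∑ i : Fin 6, LinearMap.smulRight (LinearMap.proj i : G →ₗ[ℂ] ℂ) (actB i r)

/-- An even automorphism of `osp(1|2) ⊕ u(1)`. -/
def IsEvenAut (A : G →ₗ[ℂ] G) : Prop :=
  Function.Bijective A ∧ (∀ v, isEven v → isEven (A v)) ∧
    (∀ v, isOdd v → isOdd (A v)) ∧ ∀ x y, A (mu x y) = mu (A x) (A y)

/-- The graded wedge `gᵢ ∧ gⱼ = gᵢ⊗gⱼ − (−1)^{|i||j|} gⱼ⊗gᵢ`. -/
def wdg (i j : Fin 6) : TT :=
  fun p q => (if p = i ∧ q = j then (1 : ℂ) else 0)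
    - zz i j * (if p = j ∧ q = i then (1 : ℂ) else 0)

/-- The factorwise action `A ⊗ A` on `G ⊗ G`. -/
def mapT (A : G →ₗ[ℂ] G) (s : TT) : TT :=
  fun p q => ∑ i, ∑ j, s i j * A (e i) p * A (e j) q

/-- Parity condition on `δ`. -/
def Parity (δ : G →ₗ[ℂ] TT) : Prop :=
  (∀ x, isEven x → ∀ p q : Fin 6, (gr p + gr q) % 2 = 1 → δ x p q = 0) ∧
  (∀ x, isOdd x → ∀ p q : Fin 6, (gr p + gr q) % 2 = 0 → δ x p q = 0)

/-- Graded antisymmetry of the values of `δ`. -/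
def Antisym (δ : G →ₗ[ℂ] TT) : Prop :=
  ∀ i j k : Fin 6, δ (e i) j k = - zz j k * δ (e i) k j

/-- The graded co-Jacobi identity for `f_i^{jk} = δ(gᵢ) j k`. -/
def CoJacobi (δ : G →ₗ[ℂ] TT) : Prop :=
  ∀ i k l m : Fin 6, ∑ j : Fin 6,
    (δ (e i) k j * δ (e j) l m * zz k m + δ (e i) l j * δ (e j) m k * zz l k
      + δ (e i) m j * δ (e j) k l * zz m l) = 0

/-- The 1-cocycle condition for homogeneous `x, y`. -/
def Cocycle (δ : G →ₗ[ℂ] TT) : Prop :=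
  (∀ x y, (isEven x ∨ isEven y) → δ (mu x y) = actL (δ y) x - actL (δ x) y) ∧
  (∀ x y, isOdd x → isOdd y → δ (mu x y) = actL (δ y) x + actL (δ x) y)

/-- A co-Lie structure on `osp(1|2) ⊕ u(1)`. -/
def IsCoLie (δ : G →ₗ[ℂ] TT) : Prop := Parity δ ∧ Antisym δ ∧ CoJacobi δ ∧ Cocycle δ

/-- The list of canonical `r`-matrices `r₁,…,r₇` for `osp(1|2) ⊕ u(1)`. -/
def rList (x : ℂ) : List TT :=
  [ wdg 0 1,
    wdg 3 1,
    wdg 0 1 + wdg 3 1,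
    wdg 0 1 - wdg 4 4,
    wdg 0 1 - wdg 4 4 + wdg 3 1,
    x • (wdg 1 2 + (2 : ℂ) • wdg 4 5),
    x • (wdg 1 2 + (2 : ℂ) • wdg 4 5) + wdg 0 3 ]

set_option linter.unusedSimpArgs false
set_option linter.unusedTactic false
set_option linter.unreachableTactic false
set_option linter.flexible false

theorem all6 {P : Fin 6 → Prop} (h0 : P 0) (h1 : P 1) (h2 : P 2) (h3 : P 3) (h4 : P 4)
    (h5 : P 5) : ∀ i, P i := by
  intro i
  fin_cases i
  exacts [h0, h1, h2, h3, h4, h5]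

/-- The general even graded-antisymmetric `r`-matrix: three `sl₂`-vectors. -/
def Rm (α β γ u0 up um w0 wp wm : ℂ) : TT :=
  ![![0, -β, γ, w0, 0, 0],
    ![β, 0, α/2, wp, 0, 0],
    ![-γ, -α/2, 0, wm, 0, 0],
    ![-w0, -wp, -wm, 0, 0, 0],
    ![0, 0, 0, 0, 2*up, u0],
    ![0, 0, 0, 0, u0, 2*um]]

theorem Rm_val (α β γ u0 up um w0 wp wm : ℂ) :
    Rm α β γ u0 up um w0 wp wm 0 0 = 0 ∧ Rm α β γ u0 up um w0 wp wm 0 1 = -β ∧ Rm α β γ u0 up um w0 wp wm 0 2 = γ ∧ Rm α β γ u0 up um w0 wp wm 0 3 = w0 ∧ Rm α β γ u0 up um w0 wp wm 0 4 = 0 ∧ Rm α β γ u0 up um w0 wp wm 0 5 = 0 ∧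
    Rm α β γ u0 up um w0 wp wm 1 0 = β ∧ Rm α β γ u0 up um w0 wp wm 1 1 = 0 ∧ Rm α β γ u0 up um w0 wp wm 1 2 = α/2 ∧ Rm α β γ u0 up um w0 wp wm 1 3 = wp ∧ Rm α β γ u0 up um w0 wp wm 1 4 = 0 ∧ Rm α β γ u0 up um w0 wp wm 1 5 = 0 ∧
    Rm α β γ u0 up um w0 wp wm 2 0 = -γ ∧ Rm α β γ u0 up um w0 wp wm 2 1 = -α/2 ∧ Rm α β γ u0 up um w0 wp wm 2 2 = 0 ∧ Rm α β γ u0 up um w0 wp wm 2 3 = wm ∧ Rm α β γ u0 up um w0 wp wm 2 4 = 0 ∧ Rm α β γ u0 up um w0 wp wm 2 5 = 0 ∧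
    Rm α β γ u0 up um w0 wp wm 3 0 = -w0 ∧ Rm α β γ u0 up um w0 wp wm 3 1 = -wp ∧ Rm α β γ u0 up um w0 wp wm 3 2 = -wm ∧ Rm α β γ u0 up um w0 wp wm 3 3 = 0 ∧ Rm α β γ u0 up um w0 wp wm 3 4 = 0 ∧ Rm α β γ u0 up um w0 wp wm 3 5 = 0 ∧
    Rm α β γ u0 up um w0 wp wm 4 0 = 0 ∧ Rm α β γ u0 up um w0 wp wm 4 1 = 0 ∧ Rm α β γ u0 up um w0 wp wm 4 2 = 0 ∧ Rm α β γ u0 up um w0 wp wm 4 3 = 0 ∧ Rm α β γ u0 up um w0 wp wm 4 4 = 2*up ∧ Rm α β γ u0 up um w0 wp wm 4 5 = u0 ∧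
    Rm α β γ u0 up um w0 wp wm 5 0 = 0 ∧ Rm α β γ u0 up um w0 wp wm 5 1 = 0 ∧ Rm α β γ u0 up um w0 wp wm 5 2 = 0 ∧ Rm α β γ u0 up um w0 wp wm 5 3 = 0 ∧ Rm α β γ u0 up um w0 wp wm 5 4 = u0 ∧ Rm α β γ u0 up um w0 wp wm 5 5 = 2*um := by
  refine ⟨?_, ?_, ?_, ?_, ?_, ?_, ?_, ?_, ?_, ?_, ?_, ?_, ?_, ?_, ?_, ?_, ?_, ?_,
    ?_, ?_, ?_, ?_, ?_, ?_, ?_, ?_, ?_, ?_, ?_, ?_, ?_, ?_, ?_, ?_, ?_, ?_⟩ <;> rfl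

/-- The adjoint action on coordinates. -/
def ad (v : G) : Fin 6 → Fin 6 → ℂ :=
  ![![0, v 1, -v 2, 0, v 4/2, -v 5/2],
    ![-2*v 2, -v 0, 0, 0, -v 5, 0],
    ![2*v 1, 0, v 0, 0, 0, v 4],
    ![0, 0, 0, 0, 0, 0],
    ![v 5/2, v 4/2, 0, 0, -v 0/2, -v 2],
    ![v 4/2, 0, v 5/2, 0, v 1, v 0/2]]

theorem ad_val (v : G) :
    ad v 0 0 = 0 ∧ ad v 0 1 = v 1 ∧ ad v 0 2 = -v 2 ∧ ad v 0 3 = 0 ∧ ad v 0 4 = v 4/2 ∧ ad v 0 5 = -v 5/2 ∧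
    ad v 1 0 = -2*v 2 ∧ ad v 1 1 = -v 0 ∧ ad v 1 2 = 0 ∧ ad v 1 3 = 0 ∧ ad v 1 4 = -v 5 ∧ ad v 1 5 = 0 ∧
    ad v 2 0 = 2*v 1 ∧ ad v 2 1 = 0 ∧ ad v 2 2 = v 0 ∧ ad v 2 3 = 0 ∧ ad v 2 4 = 0 ∧ ad v 2 5 = v 4 ∧
    ad v 3 0 = 0 ∧ ad v 3 1 = 0 ∧ ad v 3 2 = 0 ∧ ad v 3 3 = 0 ∧ ad v 3 4 = 0 ∧ ad v 3 5 = 0 ∧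
    ad v 4 0 = v 5/2 ∧ ad v 4 1 = v 4/2 ∧ ad v 4 2 = 0 ∧ ad v 4 3 = 0 ∧ ad v 4 4 = -v 0/2 ∧ ad v 4 5 = -v 2 ∧
    ad v 5 0 = v 4/2 ∧ ad v 5 1 = 0 ∧ ad v 5 2 = v 5/2 ∧ ad v 5 3 = 0 ∧ ad v 5 4 = v 1 ∧ ad v 5 5 = v 0/2 := by
  refine ⟨?_, ?_, ?_, ?_, ?_, ?_, ?_, ?_, ?_, ?_, ?_, ?_, ?_, ?_, ?_, ?_, ?_, ?_,
    ?_, ?_, ?_, ?_, ?_, ?_, ?_, ?_, ?_, ?_, ?_, ?_, ?_, ?_, ?_, ?_, ?_, ?_⟩ <;> rfl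

theorem ad_sum (v : G) : ∀ i p, ∑ j, c i j p * v j = ad v i p := by
  refine all6 ?_ ?_ ?_ ?_ ?_ ?_ <;> refine all6 ?_ ?_ ?_ ?_ ?_ ?_ <;>
    simp only [ad_val] <;> simp [Fin.sum_univ_six, c, cNat] <;> ring

/-- A functional evaluated on the brackets of basis vectors. -/
def br (v : G) : Fin 6 → Fin 6 → ℂ :=
  ![![0, v 1, -v 2, 0, v 4/2, -v 5/2],
    ![-v 1, 0, -2*v 0, 0, 0, -v 4],
    ![v 2, 2*v 0, 0, 0, v 5, 0],
    ![0, 0, 0, 0, 0, 0],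
    ![-v 4/2, 0, -v 5, 0, v 1/2, v 0/2],
    ![v 5/2, v 4, 0, 0, v 0/2, v 2/2]]

theorem br_val (v : G) :
    br v 0 0 = 0 ∧ br v 0 1 = v 1 ∧ br v 0 2 = -v 2 ∧ br v 0 3 = 0 ∧ br v 0 4 = v 4/2 ∧ br v 0 5 = -v 5/2 ∧
    br v 1 0 = -v 1 ∧ br v 1 1 = 0 ∧ br v 1 2 = -2*v 0 ∧ br v 1 3 = 0 ∧ br v 1 4 = 0 ∧ br v 1 5 = -v 4 ∧
    br v 2 0 = v 2 ∧ br v 2 1 = 2*v 0 ∧ br v 2 2 = 0 ∧ br v 2 3 = 0 ∧ br v 2 4 = v 5 ∧ br v 2 5 = 0 ∧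
    br v 3 0 = 0 ∧ br v 3 1 = 0 ∧ br v 3 2 = 0 ∧ br v 3 3 = 0 ∧ br v 3 4 = 0 ∧ br v 3 5 = 0 ∧
    br v 4 0 = -v 4/2 ∧ br v 4 1 = 0 ∧ br v 4 2 = -v 5 ∧ br v 4 3 = 0 ∧ br v 4 4 = v 1/2 ∧ br v 4 5 = v 0/2 ∧
    br v 5 0 = v 5/2 ∧ br v 5 1 = v 4 ∧ br v 5 2 = 0 ∧ br v 5 3 = 0 ∧ br v 5 4 = v 0/2 ∧ br v 5 5 = v 2/2 := by
  refine ⟨?_, ?_, ?_, ?_, ?_, ?_, ?_, ?_, ?_, ?_, ?_, ?_, ?_, ?_, ?_, ?_, ?_, ?_,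
    ?_, ?_, ?_, ?_, ?_, ?_, ?_, ?_, ?_, ?_, ?_, ?_, ?_, ?_, ?_, ?_, ?_, ?_⟩ <;> rfl

theorem br_sum (v : G) : ∀ i p, ∑ j, c i p j * v j = br v i p := by
  refine all6 ?_ ?_ ?_ ?_ ?_ ?_ <;> refine all6 ?_ ?_ ?_ ?_ ?_ ?_ <;>
    simp only [br_val] <;> simp [Fin.sum_univ_six, c, cNat] <;> ring

theorem zz_val :
    zz 0 0 = 1 ∧ zz 0 1 = 1 ∧ zz 0 2 = 1 ∧ zz 0 3 = 1 ∧ zz 0 4 = 1 ∧ zz 0 5 = 1 ∧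
    zz 1 0 = 1 ∧ zz 1 1 = 1 ∧ zz 1 2 = 1 ∧ zz 1 3 = 1 ∧ zz 1 4 = 1 ∧ zz 1 5 = 1 ∧
    zz 2 0 = 1 ∧ zz 2 1 = 1 ∧ zz 2 2 = 1 ∧ zz 2 3 = 1 ∧ zz 2 4 = 1 ∧ zz 2 5 = 1 ∧
    zz 3 0 = 1 ∧ zz 3 1 = 1 ∧ zz 3 2 = 1 ∧ zz 3 3 = 1 ∧ zz 3 4 = 1 ∧ zz 3 5 = 1 ∧
    zz 4 0 = 1 ∧ zz 4 1 = 1 ∧ zz 4 2 = 1 ∧ zz 4 3 = 1 ∧ zz 4 4 = -1 ∧ zz 4 5 = -1 ∧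
    zz 5 0 = 1 ∧ zz 5 1 = 1 ∧ zz 5 2 = 1 ∧ zz 5 3 = 1 ∧ zz 5 4 = -1 ∧ zz 5 5 = -1 := by
  refine ⟨?_, ?_, ?_, ?_, ?_, ?_, ?_, ?_, ?_, ?_, ?_, ?_, ?_, ?_, ?_, ?_, ?_, ?_,
    ?_, ?_, ?_, ?_, ?_, ?_, ?_, ?_, ?_, ?_, ?_, ?_, ?_, ?_, ?_, ?_, ?_, ?_⟩ <;> simp [zz, gr]

theorem actB_ad (i : Fin 6) (r : TT) (p q : Fin 6) :
    actB i r p q = ad (fun j => r j q) i p + zz i p * ad (r p) i q := by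
  simp only [actB, ad_sum]

set_option maxHeartbeats 4000000 in
theorem linear_stage (f : Fin 6 → TT)
    (hP : ∀ i p q, (gr i + gr p + gr q) % 2 = 1 → f i p q = 0)
    (hA : ∀ i p q, f i p q = - zz p q * f i q p)
    (hC0 : ∀ i j p q, ∑ k, c i j k * f k p q
      = actB i (f j) p q - zz i j * actB j (f i) p q) :
    ∃ α β γ u0 up um w0 wp wm : ℂ, ∀ i p q, f i p q = actB i (Rm α β γ u0 up um w0 wp wm) p q := by
  have hC : ∀ i j p q, br (fun k => f k p q) i j
      = ad (fun l => f j l q) i p + zz i p * ad (f j p) i q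
        - zz i j * (ad (fun l => f i l q) j p + zz j p * ad (f i p) j q) := by
    intro i j p q
    rw [← br_sum, ← actB_ad, ← actB_ad]
    exact hC0 i j p q
  have d0 : ∀ i (p : Fin 6), p.val < 4 → f i p p = 0 := by
    intro i p hp
    have := hA i p p
    simp [zz, gr, hp] at this
    grind
  have d00 := fun i => d0 i 0 (by decide)
  have d11 := fun i => d0 i 1 (by decide)
  have d22 := fun i => d0 i 2 (by decide)
  have d33 := fun i => d0 i 3 (by decide)
  have s10 : ∀ i, f i 1 0 = -f i 0 1 := by
    intro i; rw [hA i 1 0]; simp [zz, gr]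
  have s20 : ∀ i, f i 2 0 = -f i 0 2 := by
    intro i; rw [hA i 2 0]; simp [zz, gr]
  have s21 : ∀ i, f i 2 1 = -f i 1 2 := by
    intro i; rw [hA i 2 1]; simp [zz, gr]
  have s30 : ∀ i, f i 3 0 = -f i 0 3 := by
    intro i; rw [hA i 3 0]; simp [zz, gr]
  have s31 : ∀ i, f i 3 1 = -f i 1 3 := by
    intro i; rw [hA i 3 1]; simp [zz, gr]
  have s32 : ∀ i, f i 3 2 = -f i 2 3 := by
    intro i; rw [hA i 3 2]; simp [zz, gr]
  have s40 : ∀ i, f i 4 0 = -f i 0 4 := by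
    intro i; rw [hA i 4 0]; simp [zz, gr]
  have s41 : ∀ i, f i 4 1 = -f i 1 4 := by
    intro i; rw [hA i 4 1]; simp [zz, gr]
  have s42 : ∀ i, f i 4 2 = -f i 2 4 := by
    intro i; rw [hA i 4 2]; simp [zz, gr]
  have s43 : ∀ i, f i 4 3 = -f i 3 4 := by
    intro i; rw [hA i 4 3]; simp [zz, gr]
  have s50 : ∀ i, f i 5 0 = -f i 0 5 := by
    intro i; rw [hA i 5 0]; simp [zz, gr]
  have s51 : ∀ i, f i 5 1 = -f i 1 5 := by
    intro i; rw [hA i 5 1]; simp [zz, gr]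
  have s52 : ∀ i, f i 5 2 = -f i 2 5 := by
    intro i; rw [hA i 5 2]; simp [zz, gr]
  have s53 : ∀ i, f i 5 3 = -f i 3 5 := by
    intro i; rw [hA i 5 3]; simp [zz, gr]
  have s54 : ∀ i, f i 5 4 = f i 4 5 := by
    intro i; rw [hA i 5 4]; simp [zz, gr]
  have h004 : f 0 0 4 = 0 := hP _ _ _ (by decide)
  have h005 : f 0 0 5 = 0 := hP _ _ _ (by decide)
  have h014 : f 0 1 4 = 0 := hP _ _ _ (by decide)
  have h015 : f 0 1 5 = 0 := hP _ _ _ (by decide)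
  have h024 : f 0 2 4 = 0 := hP _ _ _ (by decide)
  have h025 : f 0 2 5 = 0 := hP _ _ _ (by decide)
  have h034 : f 0 3 4 = 0 := hP _ _ _ (by decide)
  have h035 : f 0 3 5 = 0 := hP _ _ _ (by decide)
  have h104 : f 1 0 4 = 0 := hP _ _ _ (by decide)
  have h105 : f 1 0 5 = 0 := hP _ _ _ (by decide)
  have h114 : f 1 1 4 = 0 := hP _ _ _ (by decide)
  have h115 : f 1 1 5 = 0 := hP _ _ _ (by decide)
  have h124 : f 1 2 4 = 0 := hP _ _ _ (by decide)
  have h125 : f 1 2 5 = 0 := hP _ _ _ (by decide)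
  have h134 : f 1 3 4 = 0 := hP _ _ _ (by decide)
  have h135 : f 1 3 5 = 0 := hP _ _ _ (by decide)
  have h204 : f 2 0 4 = 0 := hP _ _ _ (by decide)
  have h205 : f 2 0 5 = 0 := hP _ _ _ (by decide)
  have h214 : f 2 1 4 = 0 := hP _ _ _ (by decide)
  have h215 : f 2 1 5 = 0 := hP _ _ _ (by decide)
  have h224 : f 2 2 4 = 0 := hP _ _ _ (by decide)
  have h225 : f 2 2 5 = 0 := hP _ _ _ (by decide)
  have h234 : f 2 3 4 = 0 := hP _ _ _ (by decide)
  have h235 : f 2 3 5 = 0 := hP _ _ _ (by decide)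
  have h304 : f 3 0 4 = 0 := hP _ _ _ (by decide)
  have h305 : f 3 0 5 = 0 := hP _ _ _ (by decide)
  have h314 : f 3 1 4 = 0 := hP _ _ _ (by decide)
  have h315 : f 3 1 5 = 0 := hP _ _ _ (by decide)
  have h324 : f 3 2 4 = 0 := hP _ _ _ (by decide)
  have h325 : f 3 2 5 = 0 := hP _ _ _ (by decide)
  have h334 : f 3 3 4 = 0 := hP _ _ _ (by decide)
  have h335 : f 3 3 5 = 0 := hP _ _ _ (by decide)
  have h400 : f 4 0 0 = 0 := hP _ _ _ (by decide)
  have h401 : f 4 0 1 = 0 := hP _ _ _ (by decide)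
  have h402 : f 4 0 2 = 0 := hP _ _ _ (by decide)
  have h403 : f 4 0 3 = 0 := hP _ _ _ (by decide)
  have h411 : f 4 1 1 = 0 := hP _ _ _ (by decide)
  have h412 : f 4 1 2 = 0 := hP _ _ _ (by decide)
  have h413 : f 4 1 3 = 0 := hP _ _ _ (by decide)
  have h422 : f 4 2 2 = 0 := hP _ _ _ (by decide)
  have h423 : f 4 2 3 = 0 := hP _ _ _ (by decide)
  have h433 : f 4 3 3 = 0 := hP _ _ _ (by decide)
  have h444 : f 4 4 4 = 0 := hP _ _ _ (by decide)
  have h445 : f 4 4 5 = 0 := hP _ _ _ (by decide)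
  have h455 : f 4 5 5 = 0 := hP _ _ _ (by decide)
  have h500 : f 5 0 0 = 0 := hP _ _ _ (by decide)
  have h501 : f 5 0 1 = 0 := hP _ _ _ (by decide)
  have h502 : f 5 0 2 = 0 := hP _ _ _ (by decide)
  have h503 : f 5 0 3 = 0 := hP _ _ _ (by decide)
  have h511 : f 5 1 1 = 0 := hP _ _ _ (by decide)
  have h512 : f 5 1 2 = 0 := hP _ _ _ (by decide)
  have h513 : f 5 1 3 = 0 := hP _ _ _ (by decide)
  have h522 : f 5 2 2 = 0 := hP _ _ _ (by decide)
  have h523 : f 5 2 3 = 0 := hP _ _ _ (by decide)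
  have h533 : f 5 3 3 = 0 := hP _ _ _ (by decide)
  have h544 : f 5 4 4 = 0 := hP _ _ _ (by decide)
  have h545 : f 5 4 5 = 0 := hP _ _ _ (by decide)
  have h555 : f 5 5 5 = 0 := hP _ _ _ (by decide)
  obtain ⟨β, h001⟩ : ∃ t : ℂ, f 0 0 1 = -t := ⟨(-1) * f 0 0 1, by ring⟩
  obtain ⟨γ, h002⟩ : ∃ t : ℂ, f 0 0 2 = -t := ⟨(-1) * f 0 0 2, by ring⟩
  obtain ⟨up, h044⟩ : ∃ t : ℂ, f 0 4 4 = 2*t := ⟨(1/2) * f 0 4 4, by ring⟩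
  obtain ⟨um, h055⟩ : ∃ t : ℂ, f 0 5 5 = -2*t := ⟨(-1/2) * f 0 5 5, by ring⟩
  obtain ⟨wp, h013⟩ : ∃ t : ℂ, f 0 1 3 = t := ⟨(1) * f 0 1 3, by ring⟩
  obtain ⟨wm, h023⟩ : ∃ t : ℂ, f 0 2 3 = -t := ⟨(-1) * f 0 2 3, by ring⟩
  obtain ⟨α, h101⟩ : ∃ t : ℂ, f 1 0 1 = t := ⟨(1) * f 1 0 1, by ring⟩
  obtain ⟨u0, h144⟩ : ∃ t : ℂ, f 1 4 4 = -2*t := ⟨(-1/2) * f 1 4 4, by ring⟩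
  obtain ⟨w0, h113⟩ : ∃ t : ℂ, f 1 1 3 = -t := ⟨(-1) * f 1 1 3, by ring⟩
  have h012 : f 0 1 2 = 0 := by
    have t := hC 0 1 0 1
    simp only [br_val, ad_val, zz_val, d00, d11, d22, d33, s10, s20, s21, s30, s31, s32, s40, s41, s42, s43, s50, s51, s52, s53, s54] at t
    linear_combination (1/2) * t
  have h102 : f 1 0 2 = 0 := by
    have t := hC 0 1 0 2
    simp only [br_val, ad_val, zz_val, d00, d11, d22, d33, s10, s20, s21, s30, s31, s32, s40, s41, s42, s43, s50, s51, s52, s53, s54] at t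
    linear_combination (1/2) * t
  have h003 : f 0 0 3 = 0 := by
    have t := hC 0 1 1 3
    simp only [br_val, ad_val, zz_val, d00, d11, d22, d33, s10, s20, s21, s30, s31, s32, s40, s41, s42, s43, s50, s51, s52, s53, s54] at t
    linear_combination (-1) * t
  have h123 : f 1 2 3 = 0 := by
    have t := hC 0 1 2 3
    simp only [br_val, ad_val, zz_val, d00, d11, d22, d33, s10, s20, s21, s30, s31, s32, s40, s41, s42, s43, s50, s51, s52, s53, s54] at t
    linear_combination (1/2) * t
  have h045 : f 0 4 5 = 0 := by
    have t := hC 0 1 4 4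
    simp only [br_val, ad_val, zz_val, d00, d11, d22, d33, s10, s20, s21, s30, s31, s32, s40, s41, s42, s43, s50, s51, s52, s53, s54] at t
    linear_combination (-1/2) * t
  have h155 : f 1 5 5 = 0 := by
    have t := hC 0 1 5 5
    simp only [br_val, ad_val, zz_val, d00, d11, d22, d33, s10, s20, s21, s30, s31, s32, s40, s41, s42, s43, s50, s51, s52, s53, s54] at t
    linear_combination (1/2) * t
  have h201 : f 2 0 1 = 0 := by
    have t := hC 0 2 0 1
    simp only [br_val, ad_val, zz_val, d00, d11, d22, d33, s10, s20, s21, s30, s31, s32, s40, s41, s42, s43, s50, s51, s52, s53, s54] at t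
    linear_combination (-1/2) * t
  have h213 : f 2 1 3 = 0 := by
    have t := hC 0 2 1 3
    simp only [br_val, ad_val, zz_val, d00, d11, d22, d33, s10, s20, s21, s30, s31, s32, s40, s41, s42, s43, s50, s51, s52, s53, s54] at t
    linear_combination (-1/2) * t
  have h244 : f 2 4 4 = 0 := by
    have t := hC 0 2 4 4
    simp only [br_val, ad_val, zz_val, d00, d11, d22, d33, s10, s20, s21, s30, s31, s32, s40, s41, s42, s43, s50, s51, s52, s53, s54] at t
    linear_combination (-1/2) * t
  have h301 : f 3 0 1 = 0 := by
    have t := hC 0 3 0 1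
    simp only [br_val, ad_val, zz_val, d00, d11, d22, d33, s10, s20, s21, s30, s31, s32, s40, s41, s42, s43, s50, s51, s52, s53, s54] at t
    linear_combination (-1) * t
  have h302 : f 3 0 2 = 0 := by
    have t := hC 0 3 0 2
    simp only [br_val, ad_val, zz_val, d00, d11, d22, d33, s10, s20, s21, s30, s31, s32, s40, s41, s42, s43, s50, s51, s52, s53, s54] at t
    linear_combination (1) * t
  have h313 : f 3 1 3 = 0 := by
    have t := hC 0 3 1 3
    simp only [br_val, ad_val, zz_val, d00, d11, d22, d33, s10, s20, s21, s30, s31, s32, s40, s41, s42, s43, s50, s51, s52, s53, s54] at t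
    linear_combination (-1) * t
  have h323 : f 3 2 3 = 0 := by
    have t := hC 0 3 2 3
    simp only [br_val, ad_val, zz_val, d00, d11, d22, d33, s10, s20, s21, s30, s31, s32, s40, s41, s42, s43, s50, s51, s52, s53, s54] at t
    linear_combination (1) * t
  have h344 : f 3 4 4 = 0 := by
    have t := hC 0 3 4 4
    simp only [br_val, ad_val, zz_val, d00, d11, d22, d33, s10, s20, s21, s30, s31, s32, s40, s41, s42, s43, s50, s51, s52, s53, s54] at t
    linear_combination (-1) * t
  have h355 : f 3 5 5 = 0 := by
    have t := hC 0 3 5 5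
    simp only [br_val, ad_val, zz_val, d00, d11, d22, d33, s10, s20, s21, s30, s31, s32, s40, s41, s42, s43, s50, s51, s52, s53, s54] at t
    linear_combination (1) * t
  have h425 : f 4 2 5 = 0 := by
    have t := hC 0 4 2 5
    simp only [br_val, ad_val, zz_val, d00, d11, d22, d33, s10, s20, s21, s30, s31, s32, s40, s41, s42, s43, s50, s51, s52, s53, s54] at t
    linear_combination (1/2) * t
  have h514 : f 5 1 4 = 0 := by
    have t := hC 0 5 1 4
    simp only [br_val, ad_val, zz_val, d00, d11, d22, d33, s10, s20, s21, s30, s31, s32, s40, s41, s42, s43, s50, s51, s52, s53, s54] at t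
    linear_combination (-1/2) * t
  have h312 : f 3 1 2 = 0 := by
    have t := hC 1 3 0 1
    simp only [br_val, ad_val, zz_val, d00, d11, d22, d33, s10, s20, s21, s30, s31, s32, s40, s41, s42, s43, s50, s51, s52, s53, s54] at t
    linear_combination (-1/2) * t
  have h303 : f 3 0 3 = 0 := by
    have t := hC 1 3 1 3
    simp only [br_val, ad_val, zz_val, d00, d11, d22, d33, s10, s20, s21, s30, s31, s32, s40, s41, s42, s43, s50, s51, s52, s53, s54] at t
    linear_combination (1) * t
  have h345 : f 3 4 5 = 0 := by
    have t := hC 1 3 4 4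
    simp only [br_val, ad_val, zz_val, d00, d11, d22, d33, s10, s20, s21, s30, s31, s32, s40, s41, s42, s43, s50, s51, s52, s53, s54] at t
    linear_combination (1/2) * t
  have h103 : f 1 0 3 = -2*wm := by
    have t := hC 0 1 0 3
    simp only [br_val, ad_val, zz_val, d00, d11, d22, d33, s10, s20, s21, s30, s31, s32, s40, s41, s42, s43, s50, s51, s52, s53, s54, h023] at t
    linear_combination (1) * t
  have h112 : f 1 1 2 = -γ := by
    have t := hC 0 1 1 2
    simp only [br_val, ad_val, zz_val, d00, d11, d22, d33, s10, s20, s21, s30, s31, s32, s40, s41, s42, s43, s50, s51, s52, s53, s54, h002] at t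
    linear_combination (1) * t
  have h145 : f 1 4 5 = -2*um := by
    have t := hC 0 1 4 5
    simp only [br_val, ad_val, zz_val, d00, d11, d22, d33, s10, s20, s21, s30, s31, s32, s40, s41, s42, s43, s50, s51, s52, s53, s54, h055] at t
    linear_combination (1) * t
  have h203 : f 2 0 3 = 2*wp := by
    have t := hC 0 2 0 3
    simp only [br_val, ad_val, zz_val, d00, d11, d22, d33, s10, s20, s21, s30, s31, s32, s40, s41, s42, s43, s50, s51, s52, s53, s54, h013] at t
    linear_combination (-1) * t
  have h212 : f 2 1 2 = β := by
    have t := hC 0 2 1 2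
    simp only [br_val, ad_val, zz_val, d00, d11, d22, d33, s10, s20, s21, s30, s31, s32, s40, s41, s42, s43, s50, s51, s52, s53, s54, h001] at t
    linear_combination (-1) * t
  have h245 : f 2 4 5 = 2*up := by
    have t := hC 0 2 4 5
    simp only [br_val, ad_val, zz_val, d00, d11, d22, d33, s10, s20, s21, s30, s31, s32, s40, s41, s42, s43, s50, s51, s52, s53, s54, h044] at t
    linear_combination (-1) * t
  have h424 : f 4 2 4 = γ/2 := by
    have t := hC 0 4 2 4
    simp only [br_val, ad_val, zz_val, d00, d11, d22, d33, s10, s20, s21, s30, s31, s32, s40, s41, s42, s43, s50, s51, s52, s53, s54, h002] at t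
    linear_combination (1) * t
  have h435 : f 4 3 5 = wm := by
    have t := hC 0 4 3 5
    simp only [br_val, ad_val, zz_val, d00, d11, d22, d33, s10, s20, s21, s30, s31, s32, s40, s41, s42, s43, s50, s51, s52, s53, s54, h023] at t
    linear_combination (1) * t
  have h515 : f 5 1 5 = β/2 := by
    have t := hC 0 5 1 5
    simp only [br_val, ad_val, zz_val, d00, d11, d22, d33, s10, s20, s21, s30, s31, s32, s40, s41, s42, s43, s50, s51, s52, s53, s54, h001] at t
    linear_combination (-1) * t
  have h534 : f 5 3 4 = -wp := by
    have t := hC 0 5 3 4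
    simp only [br_val, ad_val, zz_val, d00, d11, d22, d33, s10, s20, s21, s30, s31, s32, s40, s41, s42, s43, s50, s51, s52, s53, s54, h013] at t
    linear_combination (-1) * t
  have h434 : f 4 3 4 = w0/2 := by
    have t := hC 4 4 1 3
    simp only [br_val, ad_val, zz_val, d00, d11, d22, d33, s10, s20, s21, s30, s31, s32, s40, s41, s42, s43, s50, s51, s52, s53, s54, h113] at t
    linear_combination (1) * t
  have h404 : f 4 0 4 = u0/2 := by
    have t := hC 4 4 4 4
    simp only [br_val, ad_val, zz_val, d00, d11, d22, d33, s10, s20, s21, s30, s31, s32, s40, s41, s42, s43, s50, s51, s52, s53, s54, h144] at t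
    linear_combination (1/2) * t
  have h405 : f 4 0 5 = um - γ := by
    have t := hC 0 4 0 5
    simp only [br_val, ad_val, zz_val, d00, d11, d22, d33, s10, s20, s21, s30, s31, s32, s40, s41, s42, s43, s50, s51, s52, s53, s54, h055, h002] at t
    linear_combination (1) * t
  have h414 : f 4 1 4 = up - β/2 := by
    have t := hC 0 4 1 4
    simp only [br_val, ad_val, zz_val, d00, d11, d22, d33, s10, s20, s21, s30, s31, s32, s40, s41, s42, s43, s50, s51, s52, s53, s54, h044, h001] at t
    linear_combination (-1) * t
  have h504 : f 5 0 4 = up - β := by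
    have t := hC 0 5 0 4
    simp only [br_val, ad_val, zz_val, d00, d11, d22, d33, s10, s20, s21, s30, s31, s32, s40, s41, s42, s43, s50, s51, s52, s53, s54, h044, h001] at t
    linear_combination (-1) * t
  have h525 : f 5 2 5 = um - γ/2 := by
    have t := hC 0 5 2 5
    simp only [br_val, ad_val, zz_val, d00, d11, d22, d33, s10, s20, s21, s30, s31, s32, s40, s41, s42, s43, s50, s51, s52, s53, s54, h055, h002] at t
    linear_combination (1) * t
  have h223 : f 2 2 3 = w0 := by
    have t := hC 1 2 0 3
    simp only [br_val, ad_val, zz_val, d00, d11, d22, d33, s10, s20, s21, s30, s31, s32, s40, s41, s42, s43, s50, s51, s52, s53, s54, h003, h113] at t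
    linear_combination (1/2) * t
  have h535 : f 5 3 5 = -w0/2 := by
    have t := hC 5 5 2 3
    simp only [br_val, ad_val, zz_val, d00, d11, d22, d33, s10, s20, s21, s30, s31, s32, s40, s41, s42, s43, s50, s51, s52, s53, s54, h223] at t
    linear_combination (1) * t
  have h202 : f 2 0 2 = α := by
    have t := hC 1 2 1 2
    simp only [br_val, ad_val, zz_val, d00, d11, d22, d33, s10, s20, s21, s30, s31, s32, s40, s41, s42, s43, s50, s51, s52, s53, s54, h012, h101] at t
    linear_combination (1) * t
  have h255 : f 2 5 5 = 2*u0 := by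
    have t := hC 1 2 4 5
    simp only [br_val, ad_val, zz_val, d00, d11, d22, d33, s10, s20, s21, s30, s31, s32, s40, s41, s42, s43, s50, s51, s52, s53, s54, h045, h144] at t
    linear_combination (1) * t
  have h505 : f 5 0 5 = u0/2 := by
    have t := hC 5 5 5 5
    simp only [br_val, ad_val, zz_val, d00, d11, d22, d33, s10, s20, s21, s30, s31, s32, s40, s41, s42, s43, s50, s51, s52, s53, s54, h255] at t
    linear_combination (-1/2) * t
  have h415 : f 4 1 5 = u0/2 - α/2 := by
    have t := hC 1 5 1 5
    simp only [br_val, ad_val, zz_val, d00, d11, d22, d33, s10, s20, s21, s30, s31, s32, s40, s41, s42, s43, s50, s51, s52, s53, s54, h505, h101] at t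
    linear_combination (-1) * t
  have h524 : f 5 2 4 = u0/2 - α/2 := by
    have t := hC 2 4 2 4
    simp only [br_val, ad_val, zz_val, d00, d11, d22, d33, s10, s20, s21, s30, s31, s32, s40, s41, s42, s43, s50, s51, s52, s53, s54, h404, h202] at t
    linear_combination (1) * t
  refine ⟨α, β, γ, u0, up, um, w0, wp, wm, ?_⟩
  refine all6 ?_ ?_ ?_ ?_ ?_ ?_ <;> refine all6 ?_ ?_ ?_ ?_ ?_ ?_ <;>
    refine all6 ?_ ?_ ?_ ?_ ?_ ?_ <;>
    simp only [actB_ad, ad_val, zz_val, Rm_val, d00, d11, d22, d33, s10, s20, s21, s30, s31, s32, s40, s41, s42, s43, s50, s51, s52, s53, s54,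
      h004, h005, h014, h015, h024, h025, h034, h035, h104, h105, h114, h115, h124, h125, h134, h135, h204, h205, h214, h215, h224, h225, h234, h235, h304, h305, h314, h315, h324, h325, h334, h335, h400, h401, h402, h403, h411, h412, h413, h422, h423, h433, h444, h445, h455, h500, h501, h502, h503, h511, h512, h513, h522, h523, h533, h544, h545, h555,
      h001, h002, h003, h012, h013, h023, h044, h045, h055, h101, h102, h103, h112, h113, h123, h144, h145, h155, h201, h202, h203, h212, h213, h223, h244, h245, h255, h301, h302, h303, h312, h313, h323, h344, h345, h355, h404, h405, h414, h415, h424, h425, h434, h435, h504, h505, h514, h515, h524, h525, h534, h535] <;> ring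

set_option maxHeartbeats 4000000 in
theorem quad_stage (f : Fin 6 → TT) (α β γ u0 up um w0 wp wm : ℂ)
    (hf : ∀ i p q, f i p q = actB i (Rm α β γ u0 up um w0 wp wm) p q)
    (hJ : ∀ i k l m : Fin 6, ∑ j : Fin 6,
      (f i k j * f j l m * zz k m + f i l j * f j m k * zz l k
        + f i m j * f j k l * zz m l) = 0) :
    (α * wp = β * w0 ∧ α * wm = γ * w0 ∧ γ * wp = β * wm) ∧
    ((u0 = α ∧ up = β ∧ um = γ) ∨ ((u0 = 0 ∧ up = 0 ∧ um = 0) ∧ α ^ 2 = 4 * β * γ)) := by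
  have e1 : α * wp = β * w0 := by
    have t := hJ 0 0 1 3
    simp only [Fin.sum_univ_six, hf, actB_ad, ad_val, zz_val, Rm_val] at t
    linear_combination (-1) * t
  have e2 : α * wm = γ * w0 := by
    have t := hJ 0 0 2 3
    simp only [Fin.sum_univ_six, hf, actB_ad, ad_val, zz_val, Rm_val] at t
    linear_combination t
  have e3 : γ * wp = β * wm := by
    have t := hJ 1 0 1 3
    simp only [Fin.sum_univ_six, hf, actB_ad, ad_val, zz_val, Rm_val] at t
    linear_combination (1 / 2) * t
  have q1 : u0 * (β - up) = 0 := by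
    have t := hJ 0 0 4 4
    simp only [Fin.sum_univ_six, hf, actB_ad, ad_val, zz_val, Rm_val] at t
    linear_combination (1 / 2) * t
  have q2 : u0 * (γ - um) = 0 := by
    have t := hJ 0 0 5 5
    simp only [Fin.sum_univ_six, hf, actB_ad, ad_val, zz_val, Rm_val] at t
    linear_combination (-1 / 2) * t
  have q3 : up * (β - up) = 0 := by
    have t := hJ 0 1 4 4
    simp only [Fin.sum_univ_six, hf, actB_ad, ad_val, zz_val, Rm_val] at t
    linear_combination (1 / 4) * t
  have q4 : up * (α - u0) = 0 := by
    have t := hJ 0 1 4 5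
    simp only [Fin.sum_univ_six, hf, actB_ad, ad_val, zz_val, Rm_val] at t
    linear_combination t
  have q5 : um * (α - u0) = 0 := by
    have t := hJ 0 2 4 5
    simp only [Fin.sum_univ_six, hf, actB_ad, ad_val, zz_val, Rm_val] at t
    linear_combination (-1) * t
  have q6 : um * (γ - um) = 0 := by
    have t := hJ 0 2 5 5
    simp only [Fin.sum_univ_six, hf, actB_ad, ad_val, zz_val, Rm_val] at t
    linear_combination (-1 / 4) * t
  have q7 : α * u0 + 2 * β * um - u0 ^ 2 - 2 * um * up = 0 := by
    have t := hJ 1 0 4 4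
    simp only [Fin.sum_univ_six, hf, actB_ad, ad_val, zz_val, Rm_val] at t
    linear_combination (-1 / 2) * t
  have q8 : α * u0 + 2 * γ * up - u0 ^ 2 - 2 * um * up = 0 := by
    have t := hJ 1 1 4 5
    simp only [Fin.sum_univ_six, hf, actB_ad, ad_val, zz_val, Rm_val] at t
    linear_combination (-1) * t
  have q9 : α ^ 2 - 2 * α * u0 - 4 * β * γ + 4 * γ * up + u0 ^ 2 = 0 := by
    have t := hJ 4 1 2 4
    simp only [Fin.sum_univ_six, hf, actB_ad, ad_val, zz_val, Rm_val] at t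
    linear_combination 4 * t
  refine ⟨⟨e1, e2, e3⟩, ?_⟩
  clear hf hJ
  by_cases hp : up = 0
  · by_cases hm : um = 0
    · by_cases h0 : u0 = 0
      · right
        subst hp hm h0
        exact ⟨⟨rfl, rfl, rfl⟩, by linear_combination q9⟩
      · left
        subst hp hm
        have a1 : β = 0 := by simpa [h0] using q1
        have a2 : γ = 0 := by simpa [h0] using q2
        have a3 : u0 * (α - u0) = 0 := by linear_combination q7
        have a4 : α - u0 = 0 := by simpa [h0] using a3
        exact ⟨by linear_combination -a4, a1.symm, a2.symm⟩
    · left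
      have a1 : α - u0 = 0 := by simpa [hm] using q5
      have a2 : γ - um = 0 := by simpa [hm] using q6
      have a3 : um * (β - up) = 0 := by linear_combination (1 / 2) * q7 - (1 / 2) * u0 * a1
      have a4 : β - up = 0 := by simpa [hm] using a3
      exact ⟨by linear_combination -a1, by linear_combination -a4, by linear_combination -a2⟩
  · left
    have a1 : α - u0 = 0 := by simpa [hp] using q4
    have a2 : β - up = 0 := by simpa [hp] using q3
    have a3 : up * (γ - um) = 0 := by linear_combination (1 / 2) * q8 - (1 / 2) * u0 * a1
    have a4 : γ - um = 0 := by simpa [hp] using a3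
    exact ⟨by linear_combination -a1, by linear_combination -a2, by linear_combination -a4⟩

/-- The even automorphism given by an `SL₂`-matrix and a scaling of `Z`. -/
def AA (a b s d l : ℂ) : G →ₗ[ℂ] G where
  toFun v := ![(a * d + b * s) * v 0 + 2 * a * s * v 1 + 2 * b * d * v 2,
    a * b * v 0 + a ^ 2 * v 1 + b ^ 2 * v 2,
    s * d * v 0 + s ^ 2 * v 1 + d ^ 2 * v 2,
    l * v 3, a * v 4 + b * v 5, s * v 4 + d * v 5]
  map_add' u v := by
    funext i; fin_cases i <;> simp <;> ring
  map_smul' t v := by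
    funext i; fin_cases i <;> simp <;> ring

theorem AA_val (a b s d l : ℂ) (v : G) :
    AA a b s d l v 0 = (a * d + b * s) * v 0 + 2 * a * s * v 1 + 2 * b * d * v 2 ∧
    AA a b s d l v 1 = a * b * v 0 + a ^ 2 * v 1 + b ^ 2 * v 2 ∧
    AA a b s d l v 2 = s * d * v 0 + s ^ 2 * v 1 + d ^ 2 * v 2 ∧
    AA a b s d l v 3 = l * v 3 ∧
    AA a b s d l v 4 = a * v 4 + b * v 5 ∧
    AA a b s d l v 5 = s * v 4 + d * v 5 := ⟨rfl, rfl, rfl, rfl, rfl, rfl⟩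

theorem mu_val (u v : G) :
    mu u v 0 = -2 * u 1 * v 2 + 2 * u 2 * v 1 + (u 4 * v 5 + u 5 * v 4) / 2 ∧
    mu u v 1 = u 0 * v 1 - u 1 * v 0 + u 4 * v 4 / 2 ∧
    mu u v 2 = u 2 * v 0 - u 0 * v 2 + u 5 * v 5 / 2 ∧
    mu u v 3 = 0 ∧
    mu u v 4 = (u 0 * v 4 - u 4 * v 0) / 2 - u 1 * v 5 + u 5 * v 1 ∧
    mu u v 5 = (u 5 * v 0 - u 0 * v 5) / 2 + u 2 * v 4 - u 4 * v 2 := by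
  refine ⟨?_, ?_, ?_, ?_, ?_, ?_⟩ <;>
    simp [mu, Fin.sum_univ_six, c, cNat] <;> ring

theorem AA_mu (a b s d l : ℂ) (h : a * d - b * s = 1) (x y : G) :
    AA a b s d l (mu x y) = mu (AA a b s d l x) (AA a b s d l y) := by
  funext i
  revert i
  refine all6 ?_ ?_ ?_ ?_ ?_ ?_ <;> simp only [AA_val, mu_val]
  · linear_combination (-1) * ((a * d + b * s) * (-2 * x 1 * y 2 + 2 * x 2 * y 1)
      + 2 * a * s * (x 0 * y 1 - x 1 * y 0) + 2 * b * d * (x 2 * y 0 - x 0 * y 2)) * h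
  · linear_combination (-1) * (a * b * (-2 * x 1 * y 2 + 2 * x 2 * y 1)
      + a ^ 2 * (x 0 * y 1 - x 1 * y 0) + b ^ 2 * (x 2 * y 0 - x 0 * y 2)) * h
  · linear_combination (-1) * (s * d * (-2 * x 1 * y 2 + 2 * x 2 * y 1)
      + s ^ 2 * (x 0 * y 1 - x 1 * y 0) + d ^ 2 * (x 2 * y 0 - x 0 * y 2)) * h
  · ring
  · linear_combination (-1) * (a * ((x 0 * y 4 - x 4 * y 0) / 2 - x 1 * y 5 + x 5 * y 1)
      + b * ((x 5 * y 0 - x 0 * y 5) / 2 + x 2 * y 4 - x 4 * y 2)) * h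
  · linear_combination (-1) * (s * ((x 0 * y 4 - x 4 * y 0) / 2 - x 1 * y 5 + x 5 * y 1)
      + d * ((x 5 * y 0 - x 0 * y 5) / 2 + x 2 * y 4 - x 4 * y 2)) * h

theorem AA_comp (a b s d l : ℂ) (h : a * d - b * s = 1) (hl : l ≠ 0) (v : G) :
    AA a b s d l (AA d (-b) (-s) a l⁻¹ v) = v := by
  funext i
  revert i
  refine all6 ?_ ?_ ?_ ?_ ?_ ?_ <;> simp only [AA_val]
  · linear_combination (v 0 * (a * d - b * s + 1)) * h
  · linear_combination (v 1 * (a * d - b * s + 1)) * h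
  · linear_combination (v 2 * (a * d - b * s + 1)) * h
  · field_simp
  · linear_combination v 4 * h
  · linear_combination v 5 * h

theorem AA_aut (a b s d l : ℂ) (h : a * d - b * s = 1) (hl : l ≠ 0) :
    IsEvenAut (AA a b s d l) := by
  refine ⟨Function.bijective_iff_has_inverse.2 ⟨AA d (-b) (-s) a l⁻¹, ?_, ?_⟩, ?_, ?_,
    AA_mu a b s d l h⟩
  · intro v
    have := AA_comp d (-b) (-s) a l⁻¹ (by linear_combination h) (inv_ne_zero hl) v
    simpa using this
  · exact AA_comp a b s d l h hl
  · intro v hv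
    have h4 := hv 4 (by decide)
    have h5 := hv 5 (by decide)
    refine all6 ?_ ?_ ?_ ?_ ?_ ?_ <;> intro hi <;> simp at hi <;> simp [AA_val, h4, h5]
  · intro v hv
    have h0 := hv 0 (by decide)
    have h1 := hv 1 (by decide)
    have h2 := hv 2 (by decide)
    have h3 := hv 3 (by decide)
    refine all6 ?_ ?_ ?_ ?_ ?_ ?_ <;> intro hi <;> simp at hi <;> simp [AA_val, h0, h1, h2, h3]

theorem mu_e (i j : Fin 6) : mu (e i) (e j) = ∑ k, c i j k • e k := by
  funext k
  simp [mu, e, Pi.single_apply]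

theorem actL_e (r : TT) (i : Fin 6) : actL r (e i) = actB i r := by
  simp [actL, e, Pi.single_apply]

theorem vec_sum (v : G) : v = ∑ i, v i • e i := by
  funext k
  simp [e, Pi.single_apply]

theorem isEven_e (i : Fin 6) (hi : i.val < 4) : isEven (e i) := by
  intro k hk
  have : k ≠ i := by rintro rfl; omega
  simp [e, this]

theorem isOdd_e (i : Fin 6) (hi : 4 ≤ i.val) : isOdd (e i) := by
  intro k hk
  have : k ≠ i := by rintro rfl; omega
  simp [e, this]

theorem aut_gr (A : G →ₗ[ℂ] G) (hA : IsEvenAut A) (i p : Fin 6) (h : gr i ≠ gr p) :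
    A (e i) p = 0 := by
  by_cases hi : i.val < 4
  · have hp : ¬ p.val < 4 := by
      intro hp; simp [gr, hi, hp] at h
    exact hA.2.1 _ (isEven_e i hi) p (by omega)
  · have hp : p.val < 4 := by
      by_contra hp; simp [gr, hi, hp] at h
    exact hA.2.2.1 _ (isOdd_e i (by omega)) p hp

theorem aut_c (A : G →ₗ[ℂ] G) (hA : IsEvenAut A) (i j p : Fin 6) :
    ∑ k, c i j k * A (e k) p = ∑ ii, ∑ jj, A (e i) ii * A (e j) jj * c ii jj p := by
  have h := congrFun (hA.2.2.2 (e i) (e j)) p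
  rw [mu_e] at h
  simpa [mu] using h

theorem aut_zz (A : G →ₗ[ℂ] G) (hA : IsEvenAut A) (i k ii p : Fin 6) :
    zz i k * (A (e i) ii * A (e k) p) = zz ii p * (A (e i) ii * A (e k) p) := by
  by_cases h1 : gr i = gr ii
  · by_cases h2 : gr k = gr p
    · simp [zz, h1, h2]
    · simp [aut_gr A hA k p h2]
  · simp [aut_gr A hA i ii h1]

theorem cocyc (δ : G →ₗ[ℂ] TT) (h : Cocycle δ) (i j p q : Fin 6) :
   ∑ k, c i j k * δ (e k) p q = actB i (δ (e j)) p q - zz i j * actB j (δ (e i)) p q := by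
  have hmu : mu (e i) (e j) = ∑ k, c i j k • e k := by
    funext k
    simp [mu, e, Pi.single_apply]
  have hact : ∀ r i, actL r (e i) = actB i r := by
    intro r i
    simp [actL, e, Pi.single_apply]
  have hE : ∀ i : Fin 6, i.val < 4 → isEven (e i) := by
    intro i hi k hk
    have : k ≠ i := by rintro rfl; omega
    simp [e, this]
  have hO : ∀ i : Fin 6, 4 ≤ i.val → isOdd (e i) := by
    intro i hi k hk
    have : k ≠ i := by rintro rfl; omega
    simp [e, this]
  have key : δ (mu (e i) (e j)) p q = ∑ k, c i j k * δ (e k) p q := by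
    rw [hmu]; simp
  rw [← key]
  by_cases hi : i.val < 4
  · rw [h.1 _ _ (Or.inl (hE i hi))]
    simp [hact, zz, gr, hi]
  · by_cases hj : j.val < 4
    · rw [h.1 _ _ (Or.inr (hE j hj))]
      simp [hact, zz, gr, hj]
    · rw [h.2 _ _ (hO i (by omega)) (hO j (by omega))]
      simp [hact, zz, gr, hi, hj]

theorem sum_swap4 (F : Fin 6 → Fin 6 → Fin 6 → Fin 6 → ℂ) :
    ∑ x, ∑ y, ∑ z, ∑ t, F x y z t = ∑ z, ∑ t, ∑ x, ∑ y, F x y z t := by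
  calc ∑ x, ∑ y, ∑ z, ∑ t, F x y z t = ∑ x, ∑ z, ∑ y, ∑ t, F x y z t :=
        Finset.sum_congr rfl fun x _ => Finset.sum_comm
    _ = ∑ z, ∑ x, ∑ y, ∑ t, F x y z t := Finset.sum_comm
    _ = ∑ z, ∑ x, ∑ t, ∑ y, F x y z t :=
        Finset.sum_congr rfl fun z _ => Finset.sum_congr rfl fun x _ => Finset.sum_comm
    _ = ∑ z, ∑ t, ∑ x, ∑ y, F x y z t := Finset.sum_congr rfl fun z _ => Finset.sum_comm

theorem mapT_actB (A : G →ₗ[ℂ] G) (hA : IsEvenAut A) (r : TT) (i : Fin 6) :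
    mapT A (actB i r) = actL (mapT A r) (A (e i)) := by
  have hR : actL (mapT A r) (A (e i)) = ∑ ii, A (e i) ii • actB ii (mapT A r) := by
    conv_lhs => rw [vec_sum (A (e i))]
    simp [actL_e]
  rw [hR]
  funext p q
  simp only [Finset.sum_apply, Pi.smul_apply, smul_eq_mul, actB, mapT, mul_add, add_mul,
    Finset.sum_add_distrib]
  congr 1
  · have L : ∑ k, ∑ l, (∑ j, c i j k * r j l) * A (e k) p * A (e l) q
        = ∑ j, ∑ l, r j l * A (e l) q * ∑ k, c i j k * A (e k) p := by
      simp only [Finset.sum_mul, Finset.mul_sum]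
      rw [Finset.sum_comm]
      conv_rhs => rw [Finset.sum_comm]
      refine Finset.sum_congr rfl fun l _ => ?_
      rw [Finset.sum_comm]
      refine Finset.sum_congr rfl fun j _ => Finset.sum_congr rfl fun k _ => ?_
      ring
    rw [L]
    simp only [aut_c A hA]
    simp only [Finset.mul_sum]
    rw [sum_swap4]
    refine Finset.sum_congr rfl fun ii _ => Finset.sum_congr rfl fun jj _ =>
      Finset.sum_congr rfl fun j _ => Finset.sum_congr rfl fun l _ => ?_
    ring
  · have L : ∑ k, ∑ l, (zz i k * ∑ j, c i j l * r k j) * A (e k) p * A (e l) q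
        = ∑ k, ∑ j, r k j * zz i k * A (e k) p * ∑ l, c i j l * A (e l) q := by
      simp only [Finset.sum_mul, Finset.mul_sum]
      refine Finset.sum_congr rfl fun k _ => ?_
      rw [Finset.sum_comm]
      refine Finset.sum_congr rfl fun j _ => Finset.sum_congr rfl fun l _ => ?_
      ring
    rw [L]
    simp only [aut_c A hA]
    simp only [Finset.mul_sum]
    rw [sum_swap4]
    refine Finset.sum_congr rfl fun ii _ => Finset.sum_congr rfl fun jj _ =>
      Finset.sum_congr rfl fun k _ => Finset.sum_congr rfl fun j _ => ?_
    linear_combination r k j * A (e j) jj * c ii jj q * aut_zz A hA i k ii p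

theorem mapT_sum (A : G →ₗ[ℂ] G) (t : Fin 6 → ℂ) (S : Fin 6 → TT) :
    mapT A (∑ i, t i • S i) = ∑ i, t i • mapT A (S i) := by
  funext p q
  simp only [mapT, Finset.sum_apply, Pi.smul_apply, smul_eq_mul, Finset.sum_mul, Finset.mul_sum]
  conv_rhs => rw [Finset.sum_comm]; enter [2, x]; rw [Finset.sum_comm]
  refine Finset.sum_congr rfl fun x _ => Finset.sum_congr rfl fun y _ =>
    Finset.sum_congr rfl fun z _ => ?_
  ring

theorem final_of (δ : G →ₗ[ℂ] TT) (r0 : TT) (h : ∀ i, δ (e i) = actB i r0)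
    (A : G →ₗ[ℂ] G) (hA : IsEvenAut A) (r : TT) (hr : mapT A r = r0) (v : G) :
    δ (A v) = mapT A (actL r v) := by
  have hd : ∀ x, δ x = actL r0 x := by
    intro x
    rw [vec_sum x]
    simp [h, actL_e]
  rw [hd, ← hr]
  have h1 : actL r v = ∑ i, v i • actB i r := by
    conv_lhs => rw [vec_sum v]
    simp [actL_e]
  rw [h1, mapT_sum]
  simp only [mapT_actB A hA]
  conv_lhs => rw [vec_sum v]
  simp only [map_sum, map_smul]

theorem AAe_val (a b s d l : ℂ) :
    AA a b s d l (e 0) 0 = a * d + b * s ∧ AA a b s d l (e 0) 1 = a * b ∧ AA a b s d l (e 0) 2 = s * d ∧ AA a b s d l (e 0) 3 = 0 ∧ AA a b s d l (e 0) 4 = 0 ∧ AA a b s d l (e 0) 5 = 0 ∧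
    AA a b s d l (e 1) 0 = 2 * a * s ∧ AA a b s d l (e 1) 1 = a ^ 2 ∧ AA a b s d l (e 1) 2 = s ^ 2 ∧ AA a b s d l (e 1) 3 = 0 ∧ AA a b s d l (e 1) 4 = 0 ∧ AA a b s d l (e 1) 5 = 0 ∧
    AA a b s d l (e 2) 0 = 2 * b * d ∧ AA a b s d l (e 2) 1 = b ^ 2 ∧ AA a b s d l (e 2) 2 = d ^ 2 ∧ AA a b s d l (e 2) 3 = 0 ∧ AA a b s d l (e 2) 4 = 0 ∧ AA a b s d l (e 2) 5 = 0 ∧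
    AA a b s d l (e 3) 0 = 0 ∧ AA a b s d l (e 3) 1 = 0 ∧ AA a b s d l (e 3) 2 = 0 ∧ AA a b s d l (e 3) 3 = l ∧ AA a b s d l (e 3) 4 = 0 ∧ AA a b s d l (e 3) 5 = 0 ∧
    AA a b s d l (e 4) 0 = 0 ∧ AA a b s d l (e 4) 1 = 0 ∧ AA a b s d l (e 4) 2 = 0 ∧ AA a b s d l (e 4) 3 = 0 ∧ AA a b s d l (e 4) 4 = a ∧ AA a b s d l (e 4) 5 = s ∧
    AA a b s d l (e 5) 0 = 0 ∧ AA a b s d l (e 5) 1 = 0 ∧ AA a b s d l (e 5) 2 = 0 ∧ AA a b s d l (e 5) 3 = 0 ∧ AA a b s d l (e 5) 4 = b ∧ AA a b s d l (e 5) 5 = d := by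
  refine ⟨?_, ?_, ?_, ?_, ?_, ?_, ?_, ?_, ?_, ?_, ?_, ?_, ?_, ?_, ?_, ?_, ?_, ?_,
    ?_, ?_, ?_, ?_, ?_, ?_, ?_, ?_, ?_, ?_, ?_, ?_, ?_, ?_, ?_, ?_, ?_, ?_⟩ <;>
    simp [AA_val, e]

set_option maxHeartbeats 4000000 in
theorem mapT_Rm (a b s d l : ℂ) (h : a * d - b * s = 1) (α β γ u0 up um w0 wp wm : ℂ) :
    mapT (AA a b s d l) (Rm α β γ u0 up um w0 wp wm) =
      Rm ((a * d + b * s) * α + 2 * a * s * β + 2 * b * d * γ)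
        (a * b * α + a ^ 2 * β + b ^ 2 * γ) (s * d * α + s ^ 2 * β + d ^ 2 * γ)
        ((a * d + b * s) * u0 + 2 * a * s * up + 2 * b * d * um)
        (a * b * u0 + a ^ 2 * up + b ^ 2 * um) (s * d * u0 + s ^ 2 * up + d ^ 2 * um)
        (l * ((a * d + b * s) * w0 + 2 * a * s * wp + 2 * b * d * wm))
        (l * (a * b * w0 + a ^ 2 * wp + b ^ 2 * wm))
        (l * (s * d * w0 + s ^ 2 * wp + d ^ 2 * wm)) := by
  funext p q
  revert p q
  refine all6 ?_ ?_ ?_ ?_ ?_ ?_ <;> refine all6 ?_ ?_ ?_ ?_ ?_ ?_ <;>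
    simp only [mapT, Fin.sum_univ_six, Rm_val, AAe_val, mul_zero, zero_mul, add_zero, zero_add]
  any_goals ring1
  · linear_combination (-(a * b * α + a ^ 2 * β + b ^ 2 * γ)) * h
  · linear_combination (s * d * α + s ^ 2 * β + d ^ 2 * γ) * h
  · linear_combination (a * b * α + a ^ 2 * β + b ^ 2 * γ) * h
  · linear_combination (((a * d + b * s) * α + 2 * a * s * β + 2 * b * d * γ) / 2) * h
  · linear_combination (-(s * d * α + s ^ 2 * β + d ^ 2 * γ)) * h
  · linear_combination (-((a * d + b * s) * α + 2 * a * s * β + 2 * b * d * γ) / 2) * h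

theorem Rm_wdg (α β γ u0 up um w0 wp wm : ℂ) :
    Rm α β γ u0 up um w0 wp wm = (α / 2) • wdg 1 2 - β • wdg 0 1 + γ • wdg 0 2
      + u0 • wdg 4 5 + up • wdg 4 4 + um • wdg 5 5
      + w0 • wdg 0 3 - wp • wdg 3 1 + wm • wdg 2 3 := by
  funext p q
  revert p q
  refine all6 ?_ ?_ ?_ ?_ ?_ ?_ <;> refine all6 ?_ ?_ ?_ ?_ ?_ ?_ <;>
    simp [Rm_val, wdg, zz_val] <;> ring

/-- Every nonzero null vector of `sl₂` is conjugate to `-X₊`. -/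
theorem conj_null (α β γ : ℂ) (h : α ^ 2 = 4 * β * γ) (h0 : ¬(α = 0 ∧ β = 0 ∧ γ = 0)) :
    ∃ a b s d : ℂ, a * d - b * s = 1 ∧ α = -(2 * a * s) ∧ β = -a ^ 2 ∧ γ = -s ^ 2 := by
  by_cases hb : β = 0
  · subst hb
    have ha : α = 0 := by simpa using h
    subst ha
    obtain ⟨t, htht⟩ := IsAlgClosed.exists_pow_nat_eq (-γ) (n := 2) (by norm_num)
    have ht := htht.symm
    have hg : γ ≠ 0 := by
      intro hg; exact h0 ⟨rfl, rfl, hg⟩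
    have ht0 : t ≠ 0 := by
      rintro rfl; apply hg; linear_combination -ht
    refine ⟨0, -t⁻¹, t, 0, by field_simp; ring, by ring, by ring, by linear_combination -ht⟩
  · obtain ⟨t, htht⟩ := IsAlgClosed.exists_pow_nat_eq (-β) (n := 2) (by norm_num)
    have ht := htht.symm
    have ht0 : t ≠ 0 := by
      rintro rfl; apply hb; linear_combination -ht
    have hbt : β = -t ^ 2 := by linear_combination -ht
    subst hbt
    refine ⟨t, 0, -α / (2 * t), t⁻¹, by field_simp; ring, by field_simp, by ring, ?_⟩
    field_simp
    linear_combination h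

/-- Every non-null vector of `sl₂` is conjugate to a multiple of `H`. -/
theorem conj_ss (α β γ : ℂ) (h : α ^ 2 ≠ 4 * β * γ) :
    ∃ a b s d y : ℂ, y ≠ 0 ∧ a * d - b * s = 1 ∧ α = y * (a * d + b * s) ∧
      β = y * (a * b) ∧ γ = y * (s * d) := by
  by_cases hb : β = 0
  · subst hb
    have ha : α ≠ 0 := by
      rintro rfl; apply h; ring
    refine ⟨1, 0, γ / α, 1, α, ha, by ring, by ring, by ring, by field_simp⟩
  · obtain ⟨y, hyhy⟩ := IsAlgClosed.exists_pow_nat_eq (α ^ 2 - 4 * β * γ) (n := 2) (by norm_num)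
    have hy := hyhy.symm
    have hy0 : y ≠ 0 := by
      rintro rfl; apply h; linear_combination hy
    refine ⟨1, β / y, (α - y) / (2 * β), (α + y) / (2 * y), y, hy0, ?_, ?_, ?_, ?_⟩
    · field_simp; ring
    · field_simp; ring
    · field_simp
    · field_simp; linear_combination -hy

theorem parallel (α β γ w0 wp wm : ℂ) (h1 : α * wp = β * w0) (h2 : α * wm = γ * w0)
    (h3 : γ * wp = β * wm) (h0 : ¬(α = 0 ∧ β = 0 ∧ γ = 0)) :
    ∃ t : ℂ, w0 = t * α ∧ wp = t * β ∧ wm = t * γ := by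
  by_cases ha : α = 0
  · by_cases hb : β = 0
    · have hg : γ ≠ 0 := fun hg => h0 ⟨ha, hb, hg⟩
      refine ⟨wm / γ, ?_, ?_, ?_⟩ <;> field_simp
      · linear_combination -h2
      · linear_combination h3
    · refine ⟨wp / β, ?_, ?_, ?_⟩ <;> field_simp
      · linear_combination -h1
      · linear_combination -h3
  · refine ⟨w0 / α, ?_, ?_, ?_⟩ <;> field_simp
    · linear_combination h1
    · linear_combination h2

/-- every co-Lie structure on `osp(1|2) ⊕ u(1)` is, up to an even
automorphism, the coboundary of one of the seven canonical `r`-matrices. -/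
theorem stmt19 (δ : G →ₗ[ℂ] TT) (hδ : IsCoLie δ) :
    ∃ A : G →ₗ[ℂ] G, IsEvenAut A ∧ ∃ x : ℂ,
      ∃ r ∈ rList x, ∀ v : G, δ (A v) = mapT A (actL r v) := by
  obtain ⟨hP, hA, hJ, hC⟩ := hδ
  have hPhP : ∀ i p q : Fin 6, (gr i + gr p + gr q) % 2 = 1 → δ (e i) p q = 0 := by
    intro i p q h
    by_cases hi : i.val < 4
    · have : gr i = 0 := by simp [gr, hi]
      exact hP.1 _ (isEven_e i hi) p q (by omega)
    · have : gr i = 1 := by simp [gr, hi]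
      exact hP.2 _ (isOdd_e i (by omega)) p q (by omega)
  obtain ⟨α, β, γ, u0, up, um, w0, wp, wm, hf⟩ :=
    linear_stage (fun i => δ (e i)) hPhP hA (cocyc δ hC)
  obtain ⟨⟨e1, e2, e3⟩, hu⟩ :=
    quad_stage (fun i => δ (e i)) α β γ u0 up um w0 wp wm hf hJ
  have hfhf : ∀ i, δ (e i) = actB i (Rm α β γ u0 up um w0 wp wm) := by
    intro i; funext p q; exact hf i p q
  -- it suffices to transform `Rm` into the list
  have key : ∀ a b s d l x : ℂ, ∀ r, a * d - b * s = 1 → l ≠ 0 → r ∈ rList x →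
      mapT (AA a b s d l) r = Rm α β γ u0 up um w0 wp wm →
      ∃ A : G →ₗ[ℂ] G, IsEvenAut A ∧ ∃ x : ℂ,
        ∃ r ∈ rList x, ∀ v : G, δ (A v) = mapT A (actL r v) := by
    intro a b s d l x r h hl hr hm
    exact ⟨_, AA_aut a b s d l h hl, x, r, hr, final_of δ _ hfhf _ (AA_aut a b s d l h hl) r hm⟩
  have m1 : Rm 0 (-1) 0 0 0 0 0 0 0 ∈ rList 0 := by
    have : Rm 0 (-1) 0 0 0 0 0 0 0 = wdg 0 1 := by rw [Rm_wdg]; module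
    simp [rList, this]
  have m2 : Rm 0 0 0 0 0 0 0 (-1) 0 ∈ rList 0 := by
    have : Rm 0 0 0 0 0 0 0 (-1) 0 = wdg 3 1 := by rw [Rm_wdg]; module
    simp [rList, this]
  have m3 : Rm 0 (-1) 0 0 0 0 0 (-1) 0 ∈ rList 0 := by
    have : Rm 0 (-1) 0 0 0 0 0 (-1) 0 = wdg 0 1 + wdg 3 1 := by rw [Rm_wdg]; module
    simp [rList, this]
  have m4 : Rm 0 (-1) 0 0 (-1) 0 0 0 0 ∈ rList 0 := by
    have : Rm 0 (-1) 0 0 (-1) 0 0 0 0 = wdg 0 1 - wdg 4 4 := by rw [Rm_wdg]; module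
    simp [rList, this]
  have m5 : Rm 0 (-1) 0 0 (-1) 0 0 (-1) 0 ∈ rList 0 := by
    have : Rm 0 (-1) 0 0 (-1) 0 0 (-1) 0 = wdg 0 1 - wdg 4 4 + wdg 3 1 := by
      rw [Rm_wdg]; module
    simp [rList, this]
  have m6 : ∀ x : ℂ, Rm (2 * x) 0 0 (2 * x) 0 0 0 0 0 ∈ rList x := by
    intro x
    have : Rm (2 * x) 0 0 (2 * x) 0 0 0 0 0 = x • (wdg 1 2 + (2 : ℂ) • wdg 4 5) := by
      rw [Rm_wdg]; module
    simp [rList, this]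
  have m7 : ∀ x : ℂ, Rm (2 * x) 0 0 (2 * x) 0 0 1 0 0 ∈ rList x := by
    intro x
    have : Rm (2 * x) 0 0 (2 * x) 0 0 1 0 0
        = x • (wdg 1 2 + (2 : ℂ) • wdg 4 5) + wdg 0 3 := by
      rw [Rm_wdg]; module
    simp [rList, this]
  by_cases h0 : α = 0 ∧ β = 0 ∧ γ = 0
  · obtain ⟨rfl, rfl, rfl⟩ := h0
    have huhu : u0 = 0 ∧ up = 0 ∧ um = 0 := by
      rcases hu with h | h
      exacts [h, h.1]
    obtain ⟨rfl, rfl, rfl⟩ := huhu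
    by_cases hw : w0 = 0 ∧ wp = 0 ∧ wm = 0
    · obtain ⟨rfl, rfl, rfl⟩ := hw
      refine key 1 0 0 1 1 0 _ (by ring) one_ne_zero (m6 0) ?_
      rw [mapT_Rm _ _ _ _ _ (by ring)]
      congr 1 <;> ring
    · by_cases hn : w0 ^ 2 = 4 * wp * wm
      · obtain ⟨a, b, s, d, h, k1, k2, k3⟩ := conj_null w0 wp wm hn hw
        refine key a b s d 1 0 _ h one_ne_zero m2 ?_
        rw [mapT_Rm _ _ _ _ _ h, k1, k2, k3]
        congr 1 <;> ring
      · obtain ⟨a, b, s, d, y, hy, h, k1, k2, k3⟩ := conj_ss w0 wp wm hn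
        refine key a b s d y 0 _ h hy (m7 0) ?_
        rw [mapT_Rm _ _ _ _ _ h, k1, k2, k3]
        congr 1 <;> ring
  · obtain ⟨t, rfl, rfl, rfl⟩ := parallel α β γ w0 wp wm e1 e2 e3 h0
    clear e1 e2 e3
    by_cases hn : α ^ 2 = 4 * β * γ
    · obtain ⟨a, b, s, d, h, k1, k2, k3⟩ := conj_null α β γ hn h0
      clear hn h0
      have huhu : (u0 = α ∧ up = β ∧ um = γ) ∨ (u0 = 0 ∧ up = 0 ∧ um = 0) := by
        rcases hu with h | h
        exacts [Or.inl h, Or.inr h.1]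
      rcases huhu with ⟨rfl, rfl, rfl⟩ | ⟨rfl, rfl, rfl⟩ <;> by_cases ht : t = 0
      · refine key a b s d 1 0 _ h one_ne_zero m4 ?_
        rw [mapT_Rm _ _ _ _ _ h, k1, k2, k3, ht]
        congr 1 <;> ring
      · refine key a b s d t 0 _ h ht m5 ?_
        rw [mapT_Rm _ _ _ _ _ h, k1, k2, k3]
        congr 1 <;> ring
      · refine key a b s d 1 0 _ h one_ne_zero m1 ?_
        rw [mapT_Rm _ _ _ _ _ h, k1, k2, k3, ht]
        congr 1 <;> ring
      · refine key a b s d t 0 _ h ht m3 ?_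
        rw [mapT_Rm _ _ _ _ _ h, k1, k2, k3]
        congr 1 <;> ring
    · obtain ⟨a, b, s, d, y, hy, h, k1, k2, k3⟩ := conj_ss α β γ hn
      obtain ⟨rfl, rfl, rfl⟩ : u0 = α ∧ up = β ∧ um = γ := by
        rcases hu with h | h
        exacts [h, absurd h.2 hn]
      clear hn h0 hu
      by_cases ht : t = 0
      · refine key a b s d 1 (y / 2) _ h one_ne_zero (m6 _) ?_
        rw [mapT_Rm _ _ _ _ _ h, k1, k2, k3, ht]
        congr 1 <;> ring
      · refine key a b s d (t * y) (y / 2) _ h (mul_ne_zero ht hy) (m7 _) ?_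
        rw [mapT_Rm _ _ _ _ _ h, k1, k2, k3]
        congr 1 <;> ring

end
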